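/- Let A and B be coaugmented chain coalgebras over a commutative ring R of characteristic 2, and let h be the natural degree +1 homotopy on Ω(A⊗B). Then for every word ω, every b ∈ B̄, every word α of letters from Ā, and every word β of letters from B̄, h([ω](d[b|α])[β]) = [ω](hd[b|α])[β] + h([ω](d[α|b])[β]). -/

import Mathlib

open scoped TensorProduct
open DirectSum

noncomputable section
namespace CJ2

/-- Cast along an equality of indices in a graded module. -/
def pcast {R : Type} [CommRing R] {A : ℕ → Type} [∀ n, AddCommGroup (A n)]
    [∀ n, Module R (A n)] {m n : ℕ} (h : m = n) : A m →ₗ[R] A n where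
  toFun x := h ▸ x
  map_add' := by subst h; intros; rfl
  map_smul' := by subst h; intros; rfl

/-- A coaugmented chain coalgebra over `R`, presented componentwise: a non-negatively
graded `R`-module `A` with differential `d` of degree `-1`, comultiplication given by
its components `comul p q : A (p+q) → A p ⊗ A q`, counit and coaugmentation, subject to
the usual axioms (coassociativity, counit laws, co-Leibniz rule, `d² = 0`). -/
structure CoalgStr (R : Type) [CommRing R] (A : ℕ → Type)
    [∀ n, AddCommGroup (A n)] [∀ n, Module R (A n)] where
  d : ∀ n, A (n+1) →ₗ[R] A n
  dd : ∀ (n : ℕ) (x : A (n+2)), d n (d (n+1) x) = 0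
  comul : ∀ p q, A (p+q) →ₗ[R] (A p ⊗[R] A q)
  counit : A 0 →ₗ[R] R
  coaug : R →ₗ[R] A 0
  counit_coaug : counit (coaug 1) = 1
  coaug_grouplike : comul 0 0 (coaug 1) = coaug 1 ⊗ₜ[R] coaug 1
  comul_counit : ∀ (n : ℕ) (x : A n),
    TensorProduct.rid R (A n) ((TensorProduct.map LinearMap.id counit) (comul n 0 x)) = x
  counit_comul : ∀ (n : ℕ) (x : A n),
    TensorProduct.lid R (A n) ((TensorProduct.map counit LinearMap.id)
      (comul 0 n (pcast (R := R) (A := A) (Nat.zero_add n).symm x))) = x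
  coassoc : ∀ (p q r : ℕ) (x : A (p+q+r)),
    TensorProduct.assoc R (A p) (A q) (A r)
        ((TensorProduct.map (comul p q) LinearMap.id) (comul (p+q) r x))
      = (TensorProduct.map LinearMap.id (comul q r)) (comul p (q+r) (pcast (R := R) (A := A) (Nat.add_assoc p q r) x))
  coleib : ∀ (p q : ℕ) (x : A (p+q+1)),
    comul p q (d (p+q) x)
      = (TensorProduct.map (d p) LinearMap.id) (comul (p+1) q (pcast (R := R) (A := A) (by omega) x))
        + ((-1 : ℤ)^p) • (TensorProduct.map LinearMap.id (d q)) (comul p (q+1) (pcast (R := R) (A := A) (by omega) x))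
  counit_d : ∀ x : A 1, counit (d 0 x) = 0

section Setup

variable {R : Type} [CommRing R]
variable (A : ℕ → Type) [∀ n, AddCommGroup (A n)] [∀ n, Module R (A n)] (CA : CoalgStr R A)

/-- The reduced part `Ā` of a coaugmented chain coalgebra:
`ker ε` in degree 0, everything in positive degree. -/
def redT : ℕ → Type
  | 0 => ↥(LinearMap.ker CA.counit)
  | n+1 => A (n+1)

instance redT.acg : ∀ n, AddCommGroup (redT A CA n)
  | 0 => inferInstanceAs (AddCommGroup ↥(LinearMap.ker CA.counit))
  | n+1 => inferInstanceAs (AddCommGroup (A (n+1)))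

instance redT.mod : ∀ n, Module R (redT A CA n)
  | 0 => inferInstanceAs (Module R ↥(LinearMap.ker CA.counit))
  | n+1 => inferInstanceAs (Module R (A (n+1)))

/-- The total module of the reduced coalgebra `Ā`. -/
abbrev Big := ⨁ n, redT A CA n

/-- Reduction `A n → Ā n`: in degree 0 it kills the coaugmentation
(`x ↦ x - η(ε x)`), in positive degrees the identity. -/
def toRed : ∀ n, A n →ₗ[R] redT A CA n
  | 0 => LinearMap.codRestrict (LinearMap.ker CA.counit)
      (LinearMap.id - CA.coaug ∘ₗ CA.counit)
      (fun x => by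
        have h1 : CA.coaug (CA.counit x) = CA.counit x • CA.coaug 1 := by
          rw [← map_smul, smul_eq_mul, mul_one]
        simp only [LinearMap.mem_ker, LinearMap.sub_apply, LinearMap.id_apply,
          LinearMap.coe_comp, Function.comp_apply, map_sub, h1, map_smul,
          CA.counit_coaug, smul_eq_mul, mul_one, sub_self])
  | n+1 => LinearMap.id

/-- The embedding of a homogeneous component of `A` into `Ā`
(killing the coaugmentation in degree 0). -/
def embT (n : ℕ) : A n →ₗ[R] Big A CA :=
  (DirectSum.lof R ℕ (redT A CA) n).comp (toRed A CA n)

/-- The degree-0 "counit" of the component `A q` (the counit for `q = 0`, else `0`). -/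
def epsAt : ∀ q, A q →ₗ[R] R
  | 0 => CA.counit
  | _+1 => 0

/-- The value of the reduced diagonal `Δ̄` on a homogeneous element,
as an element of `Ā ⊗ Ā` (the embeddings kill the primitive terms). -/
def bigDiag (p : ℕ) : A p →ₗ[R] (Big A CA ⊗[R] Big A CA) :=
  ∑ j : Fin (p+1),
    (TensorProduct.map (embT A CA j.1) (embT A CA (p - j.1))).comp
      ((CA.comul j.1 (p - j.1)).comp (pcast (R := R) (A := A) (by have := j.is_le; omega)))

end Setup

section TwoCoalgebras

variable {R : Type} [CommRing R]
variable (A : ℕ → Type) [∀ n, AddCommGroup (A n)] [∀ n, Module R (A n)] (CA : CoalgStr R A)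
variable (B : ℕ → Type) [∀ n, AddCommGroup (B n)] [∀ n, Module R (B n)] (CB : CoalgStr R B)

/-- The module of generators of `Ω (A ⊗ B)`: the reduced part
`(A ⊗ B)‾ = (Ā ⊗ B̄) ⊕ Ā ⊕ B̄`. -/
abbrev WW := (Big A CA ⊗[R] Big B CB) × Big A CA × Big B CB

/-- The underlying algebra of the cobar construction `Ω (A ⊗ B)`. -/
abbrev Om := TensorAlgebra R (WW A CA B CB)

/-- The underlying algebra of `Ω A`. -/
abbrev OmA := TensorAlgebra R (Big A CA)

/-- The underlying algebra of `Ω B`. -/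
abbrev OmB := TensorAlgebra R (Big B CB)

/-- The letter `[a]`, `a ∈ Ā`. -/
def lA : Big A CA →ₗ[R] WW A CA B CB := LinearMap.prod 0 (LinearMap.prod LinearMap.id 0)

/-- The letter `[b]`, `b ∈ B̄`. -/
def lB : Big B CB →ₗ[R] WW A CA B CB := LinearMap.prod 0 (LinearMap.prod 0 LinearMap.id)

/-- The letter `[ab]`, `a ∈ Ā`, `b ∈ B̄`. -/
def lT : (Big A CA ⊗[R] Big B CB) →ₗ[R] WW A CA B CB := LinearMap.prod LinearMap.id 0

/-- The length-one word `[a]` in `Ω (A ⊗ B)`. -/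
def genA (x : Big A CA) : Om A CA B CB := TensorAlgebra.ι R (lA A CA B CB x)

/-- The length-one word `[b]` in `Ω (A ⊗ B)`. -/
def genB (y : Big B CB) : Om A CA B CB := TensorAlgebra.ι R (lB A CA B CB y)

/-- The length-one word `[ab]` in `Ω (A ⊗ B)`. -/
def genT (t : Big A CA ⊗[R] Big B CB) : Om A CA B CB := TensorAlgebra.ι R (lT A CA B CB t)

/-- The generator of `Ω(A⊗B)` corresponding to a homogeneous element of `A_p ⊗ B_q`
(decomposed into its `[āb̄]`, `[ā]`, `[b̄]` parts). -/
def Γg (p q : ℕ) : (A p ⊗[R] B q) →ₗ[R] WW A CA B CB :=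
  LinearMap.prod (TensorProduct.map (embT A CA p) (embT B CB q))
    (LinearMap.prod
      ((embT A CA p).comp ((TensorProduct.rid R (A p)).toLinearMap.comp
        (TensorProduct.map LinearMap.id (epsAt B CB q))))
      ((embT B CB q).comp ((TensorProduct.lid R (B q)).toLinearMap.comp
        (TensorProduct.map (epsAt A CA p) LinearMap.id))))

/-- The length-one word of `Ω (A ⊗ B)` on a homogeneous element of `A_p ⊗ B_q`. -/
def genW (p q : ℕ) (z : A p ⊗[R] B q) : Om A CA B CB :=
  TensorAlgebra.ι R (Γg A CA B CB p q z)

/-- The generator values of the Milgram map: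
`[a ⊗ 1] ↦ [a] ⊗ [ ]`, `[1 ⊗ b] ↦ [ ] ⊗ [b]`, `[a ⊗ b] ↦ 0`. -/
def qgen : WW A CA B CB →ₗ[R] (OmA A CA ⊗[R] OmB B CB) :=
  ((TensorProduct.mk R (OmA A CA) (OmB B CB)).flip 1).comp
      ((TensorAlgebra.ι R).comp
        ((LinearMap.fst R (Big A CA) (Big B CB)).comp
          (LinearMap.snd R (Big A CA ⊗[R] Big B CB) (Big A CA × Big B CB))))
  + (TensorProduct.mk R (OmA A CA) (OmB B CB) 1).comp
      ((TensorAlgebra.ι R).comp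
        ((LinearMap.snd R (Big A CA) (Big B CB)).comp
          (LinearMap.snd R (Big A CA ⊗[R] Big B CB) (Big A CA × Big B CB))))

/-- The Milgram map `q : Ω (A ⊗ B) → Ω A ⊗ Ω B`. -/
def qMil : Om A CA B CB →ₐ[R] (OmA A CA ⊗[R] OmB B CB) :=
  TensorAlgebra.lift R (qgen A CA B CB)

/-- `Ω i_A : Ω A → Ω (A ⊗ B)`. -/
def OiA : OmA A CA →ₐ[R] Om A CA B CB :=
  TensorAlgebra.lift R ((TensorAlgebra.ι R).comp (lA A CA B CB))

/-- `Ω i_B : Ω B → Ω (A ⊗ B)`. -/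
def OiB : OmB B CB →ₐ[R] Om A CA B CB :=
  TensorAlgebra.lift R ((TensorAlgebra.ι R).comp (lB A CA B CB))

/-- The natural section `σ : Ω A ⊗ Ω B → Ω (A ⊗ B)`,
`σ (u ⊗ v) = Ω i_A (u) · Ω i_B (v)`. -/
def sigmaMil : (OmA A CA ⊗[R] OmB B CB) →ₗ[R] Om A CA B CB :=
  TensorProduct.lift ((LinearMap.mul R (Om A CA B CB)).compl₁₂
    (OiA A CA B CB).toLinearMap (OiB A CA B CB).toLinearMap)

/-- Bilinear multiplication helper: `(m ⊗ n) ↦ f m * g n`. -/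
def mul2 {M N P : Type} [AddCommGroup M] [Module R M] [AddCommGroup N] [Module R N]
    [Ring P] [Algebra R P] (f : M →ₗ[R] P) (g : N →ₗ[R] P) : (M ⊗[R] N) →ₗ[R] P :=
  TensorProduct.lift ((LinearMap.mul R P).compl₁₂ f g)

/-- The word in `Ω (A ⊗ B)` given by a list of homogeneous letters from `Ā`. -/
def wordA (l : List ((p : ℕ) × A p)) : Om A CA B CB :=
  (l.map fun t => genA A CA B CB (embT A CA t.1 t.2)).prod

/-- The word in `Ω (A ⊗ B)` given by a list of homogeneous letters from `B̄`. -/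
def wordB (l : List ((q : ℕ) × B q)) : Om A CA B CB :=
  (l.map fun t => genB A CA B CB (embT B CB t.1 t.2)).prod

/-- The word in `Ω (A ⊗ B)` given by a list of general homogeneous letters. -/
def wordW (l : List ((pq : ℕ × ℕ) × (A pq.1 ⊗[R] B pq.2))) : Om A CA B CB :=
  (l.map fun t => genW A CA B CB t.1.1 t.1.2 t.2).prod

/-- Parity of the cobar degree of a word of `Ā`-letters. -/
def degA (l : List ((p : ℕ) × A p)) : ℕ := (l.map fun t => t.1).sum + l.length

/-- Parity of the cobar degree of a word of general letters. -/
def degW (l : List ((pq : ℕ × ℕ) × (A pq.1 ⊗[R] B pq.2))) : ℕ :=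
  (l.map fun t => t.1.1 + t.1.2).sum + l.length

/-- The Sweedler-type operation `(b₁ ⊗ b₂) ↦ h([b₁ | α]) · [a b₂]`. -/
def sweedC (h : Om A CA B CB →ₗ[R] Om A CA B CB) (α : List ((p : ℕ) × A p))
    (x : Big A CA) : (Big B CB ⊗[R] Big B CB) →ₗ[R] Om A CA B CB :=
  TensorProduct.lift ((LinearMap.mul R (Om A CA B CB)).compl₁₂
    (h ∘ₗ (LinearMap.mulRight R (wordA A CA B CB α)) ∘ₗ (TensorAlgebra.ι R) ∘ₗ lB A CA B CB)
    ((TensorAlgebra.ι R) ∘ₗ (lT A CA B CB) ∘ₗ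
      (TensorProduct.mk R (Big A CA) (Big B CB) x)))

/-- The Sweedler-type operation `(b₁ ⊗ b₂) ↦ [a b₁] · h([b₂ | α])`. -/
def sweedC2 (h : Om A CA B CB →ₗ[R] Om A CA B CB) (α : List ((p : ℕ) × A p))
    (x : Big A CA) : (Big B CB ⊗[R] Big B CB) →ₗ[R] Om A CA B CB :=
  TensorProduct.lift ((LinearMap.mul R (Om A CA B CB)).compl₁₂
    ((TensorAlgebra.ι R) ∘ₗ (lT A CA B CB) ∘ₗ
      (TensorProduct.mk R (Big A CA) (Big B CB) x))
    (h ∘ₗ (LinearMap.mulRight R (wordA A CA B CB α)) ∘ₗ (TensorAlgebra.ι R) ∘ₗ lB A CA B CB))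

end TwoCoalgebras

section CobarValues

variable {R : Type} [CommRing R]
variable (A : ℕ → Type) [∀ n, AddCommGroup (A n)] [∀ n, Module R (A n)] (CA : CoalgStr R A)

/-- The linear part `[dx]` of the cobar differential of `Ω A` on a generator. -/
def linAA : ∀ p, A p →ₗ[R] OmA A CA
  | 0 => 0
  | p+1 => (TensorAlgebra.ι R).comp ((embT A CA p).comp (CA.d p))

/-- The quadratic part `∑ (-1)^{deg x₍₁₎} [x₍₁₎|x₍₂₎]` of the cobar differential of
`Ω A` on a generator. -/
def quadAA (p : ℕ) : A p →ₗ[R] OmA A CA :=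
  ∑ j : Fin (p+1), ((-1 : ℤ)^(j.1)) •
    ((mul2 (TensorAlgebra.ι R) (TensorAlgebra.ι R)).comp
      ((TensorProduct.map (embT A CA j.1) (embT A CA (p - j.1))).comp
        ((CA.comul j.1 (p - j.1)).comp (pcast (R := R) (A := A) (by have := j.is_le; omega)))))

/-- The value of the cobar differential of `Ω A` on the generator given by a homogeneous
element: `d_Ω [x] = -[dx] + ∑ (-1)^{deg x₍₁₎} [x₍₁₎|x₍₂₎]`. -/
def dvalAA (p : ℕ) : A p →ₗ[R] OmA A CA := - linAA A CA p + quadAA A CA p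

/-- The word of `Ω A` given by a list of homogeneous letters. -/
def wordAlg (l : List ((p : ℕ) × A p)) : OmA A CA :=
  (l.map fun t => TensorAlgebra.ι R (embT A CA t.1 t.2)).prod

end CobarValues

section CobarValuesT

variable {R : Type} [CommRing R]
variable (A : ℕ → Type) [∀ n, AddCommGroup (A n)] [∀ n, Module R (A n)] (CA : CoalgStr R A)
variable (B : ℕ → Type) [∀ n, AddCommGroup (B n)] [∀ n, Module R (B n)] (CB : CoalgStr R B)

/-- `[(da) b]` : the `A`-part of the linear term of the cobar differential of
`Ω (A ⊗ B)` on a generator of bidegree `(p,q)`. -/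
def linT1 : ∀ (p q : ℕ), (A p ⊗[R] B q) →ₗ[R] Om A CA B CB
  | 0, _ => 0
  | p+1, q => ((TensorAlgebra.ι R).comp (Γg A CA B CB p q)).comp
      (TensorProduct.map (CA.d p) LinearMap.id)

/-- `(-1)^p [a (db)]` : the `B`-part of the linear term. -/
def linT2 : ∀ (p q : ℕ), (A p ⊗[R] B q) →ₗ[R] Om A CA B CB
  | _, 0 => 0
  | p, q+1 => ((-1 : ℤ)^p) • (((TensorAlgebra.ι R).comp (Γg A CA B CB p q)).comp
      (TensorProduct.map LinearMap.id (CB.d q)))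

/-- The quadratic (Künneth) part of the cobar differential of `Ω (A ⊗ B)` on a
generator of bidegree `(p,q)`:
`∑ (-1)^{q₁p₂} (-1)^{p₁+q₁} [a₍₁₎b₍₁₎ | a₍₂₎b₍₂₎]` (primitive terms being killed by
the reduction embeddings). -/
def quadT (p q : ℕ) : (A p ⊗[R] B q) →ₗ[R] Om A CA B CB :=
  ∑ j : Fin (p+1), ∑ k : Fin (q+1),
    ((-1 : ℤ)^(k.1 * (p - j.1) + j.1 + k.1)) •
      ((mul2 ((TensorAlgebra.ι R).comp (Γg A CA B CB j.1 k.1))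
             ((TensorAlgebra.ι R).comp (Γg A CA B CB (p - j.1) (q - k.1)))).comp
        ((TensorProduct.tensorTensorTensorComm R (A j.1) (A (p - j.1)) (B k.1) (B (q - k.1))).toLinearMap.comp
          (TensorProduct.map
            ((CA.comul j.1 (p - j.1)).comp (pcast (R := R) (A := A) (by have := j.is_le; omega)))
            ((CB.comul k.1 (q - k.1)).comp (pcast (R := R) (A := B) (by have := k.is_le; omega))))))

/-- The value of the cobar differential of `Ω (A ⊗ B)` on the generator given by a
homogeneous element of `A_p ⊗ B_q`:
`d_Ω [w] = -[d_{A⊗B} w] + ∑ (-1)^{deg w₍₁₎} [w₍₁₎ | w₍₂₎]`. -/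
def dvalT (p q : ℕ) : (A p ⊗[R] B q) →ₗ[R] Om A CA B CB :=
  - linT1 A CA B CB p q - linT2 A CA B CB p q + quadT A CA B CB p q

end CobarValuesT

section CharTwo

variable {R : Type} [CommRing R] [CharP R 2] {M : Type} [AddCommGroup M] [Module R M]

include R in
theorem neg_one_pow_zsmul_of_charP_two (n : ℕ) (x : M) : ((-1 : ℤ) ^ n) • x = x := by
  have hx : -x = x := by
    rw [neg_eq_iff_add_eq_zero, ← two_smul R x, CharTwo.two_eq_zero, zero_smul]
  rcases neg_one_pow_eq_or ℤ n with hn | hn <;> simp [hn, hx]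

end CharTwo

section Coaugmentation

variable {R : Type} [CommRing R]
variable (A : ℕ → Type) [∀ n, AddCommGroup (A n)] [∀ n, Module R (A n)] (CA : CoalgStr R A)
variable (B : ℕ → Type) [∀ n, AddCommGroup (B n)] [∀ n, Module R (B n)] (CB : CoalgStr R B)

theorem embT_coaug_one : embT A CA 0 (CA.coaug 1) = 0 := by
  have : toRed A CA 0 (CA.coaug 1) = 0 := by
    apply Subtype.ext
    change CA.coaug 1 - CA.coaug (CA.counit (CA.coaug 1)) = 0
    rw [CA.counit_coaug, sub_self]
  rw [embT, LinearMap.comp_apply, this, map_zero]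

theorem genW_coaug_tmul (q : ℕ) (b : B q) :
    genW A CA B CB 0 q (CA.coaug 1 ⊗ₜ[R] b) = genB A CA B CB (embT B CB q b) := by
  simp [genW, genB, Γg, lB, embT_coaug_one, epsAt, CA.counit_coaug]

theorem genW_tmul_coaug (p : ℕ) (a : A p) :
    genW A CA B CB p 0 (a ⊗ₜ[R] CB.coaug 1) = genA A CA B CB (embT A CA p a) := by
  simp [genW, genA, Γg, lA, embT_coaug_one, epsAt, CB.counit_coaug]

theorem mul2_ι_Γg_tmul (p q p' q' : ℕ) (z : A p ⊗[R] B q) (z' : A p' ⊗[R] B q') :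
    mul2 ((TensorAlgebra.ι R).comp (Γg A CA B CB p q))
        ((TensorAlgebra.ι R).comp (Γg A CA B CB p' q')) (z ⊗ₜ[R] z')
      = genW A CA B CB p q z * genW A CA B CB p' q' z' := rfl

/-- The submodule of `Ω (A ⊗ B)` spanned by the nonempty words of letters from `Ā`. -/
def spanWordA : Submodule R (Om A CA B CB) :=
  Submodule.span R {u | ∃ l : List ((p : ℕ) × A p), l ≠ [] ∧ wordA A CA B CB l = u}

/-- The submodule of `Ω (A ⊗ B)` spanned by the words of letters from `B̄`. -/
def spanWordB : Submodule R (Om A CA B CB) :=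
  Submodule.span R (Set.range (wordB A CA B CB))

@[simp]
theorem wordA_nil : wordA A CA B CB [] = 1 := rfl

@[simp]
theorem wordB_nil : wordB A CA B CB [] = 1 := rfl

theorem wordA_cons (t : (p : ℕ) × A p) (l : List ((p : ℕ) × A p)) :
    wordA A CA B CB (t :: l) = genA A CA B CB (embT A CA t.1 t.2) * wordA A CA B CB l := by
  simp [wordA]

theorem wordB_cons (t : (q : ℕ) × B q) (l : List ((q : ℕ) × B q)) :
    wordB A CA B CB (t :: l) = genB A CA B CB (embT B CB t.1 t.2) * wordB A CA B CB l := by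
  simp [wordB]

theorem wordA_append (l l' : List ((p : ℕ) × A p)) :
    wordA A CA B CB (l ++ l') = wordA A CA B CB l * wordA A CA B CB l' := by
  simp [wordA]

theorem wordB_append (l l' : List ((q : ℕ) × B q)) :
    wordB A CA B CB (l ++ l') = wordB A CA B CB l * wordB A CA B CB l' := by
  simp [wordB]

theorem genA_mem_spanWordA (p : ℕ) (a : A p) :
    genA A CA B CB (embT A CA p a) ∈ spanWordA A CA B CB :=
  Submodule.subset_span ⟨[⟨p, a⟩], by simp, by simp [wordA]⟩

theorem genB_mem_spanWordB (q : ℕ) (b : B q) :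
    genB A CA B CB (embT B CB q b) ∈ spanWordB A CA B CB :=
  Submodule.subset_span ⟨[⟨q, b⟩], by simp [wordB]⟩

theorem mul_wordA_mem_spanWordA {u : Om A CA B CB} (hu : u ∈ spanWordA A CA B CB)
    (l : List ((p : ℕ) × A p)) : u * wordA A CA B CB l ∈ spanWordA A CA B CB := by
  induction hu using Submodule.span_induction with
  | mem u hu =>
    obtain ⟨l', hl', rfl⟩ := hu
    exact Submodule.subset_span ⟨l' ++ l, by simp [hl'], wordA_append A CA B CB l' l⟩
  | zero => simp
  | add u v _ _ hu hv => rw [add_mul]; exact add_mem hu hv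
  | smul r u _ hu => rw [smul_mul_assoc]; exact Submodule.smul_mem _ r hu

theorem genA_mul_mem_spanWordA (p : ℕ) (a : A p) {u : Om A CA B CB}
    (hu : u ∈ spanWordA A CA B CB) :
    genA A CA B CB (embT A CA p a) * u ∈ spanWordA A CA B CB := by
  induction hu using Submodule.span_induction with
  | mem u hu =>
    obtain ⟨l, -, rfl⟩ := hu
    exact Submodule.subset_span ⟨⟨p, a⟩ :: l, by simp, wordA_cons A CA B CB ⟨p, a⟩ l⟩
  | zero => simp
  | add u v _ _ hu hv => rw [mul_add]; exact add_mem hu hv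
  | smul r u _ hu => rw [mul_smul_comm]; exact Submodule.smul_mem _ r hu

theorem genB_mul_genB_mem_spanWordB (q q' : ℕ) (b : B q) (b' : B q') :
    genB A CA B CB (embT B CB q b) * genB A CA B CB (embT B CB q' b')
      ∈ spanWordB A CA B CB :=
  Submodule.subset_span ⟨[⟨q, b⟩, ⟨q', b'⟩], by simp [wordB]⟩

theorem quadT_coaug_tmul_mem (q : ℕ) (b : B q) :
    quadT A CA B CB 0 q (CA.coaug 1 ⊗ₜ[R] b) ∈ spanWordB A CA B CB := by
  rw [quadT, LinearMap.sum_apply]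
  refine sum_mem fun j _ => ?_
  obtain rfl : j = 0 := Fin.fin_one_eq_zero _
  rw [LinearMap.sum_apply]
  refine sum_mem fun k _ => ?_
  rw [LinearMap.smul_apply]
  refine zsmul_mem ?_ _
  simp only [LinearMap.comp_apply, TensorProduct.map_tmul]
  generalize CB.comul k.1 (q - k.1) _ = t
  change mul2 ((TensorAlgebra.ι R).comp (Γg A CA B CB 0 k.1))
    ((TensorAlgebra.ι R).comp (Γg A CA B CB 0 (q - k.1)))
    (TensorProduct.tensorTensorTensorComm R (A 0) (A 0) (B k.1) (B (q - k.1))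
      (CA.comul 0 0 (CA.coaug 1) ⊗ₜ[R] t)) ∈ _
  rw [CA.coaug_grouplike]
  induction t using TensorProduct.induction_on with
  | zero => simp
  | tmul x y =>
    rw [TensorProduct.tensorTensorTensorComm_tmul, mul2_ι_Γg_tmul, genW_coaug_tmul,
      genW_coaug_tmul]
    exact genB_mul_genB_mem_spanWordB A CA B CB _ _ x y
  | add x y hx hy => rw [TensorProduct.tmul_add, map_add, map_add]; exact add_mem hx hy

theorem quadT_tmul_coaug_mem (p : ℕ) (a : A p) :
    quadT A CA B CB p 0 (a ⊗ₜ[R] CB.coaug 1) ∈ spanWordA A CA B CB := by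
  rw [quadT, LinearMap.sum_apply]
  refine sum_mem fun j _ => ?_
  rw [LinearMap.sum_apply]
  refine sum_mem fun k _ => ?_
  obtain rfl : k = 0 := Fin.fin_one_eq_zero _
  rw [LinearMap.smul_apply]
  refine zsmul_mem ?_ _
  simp only [LinearMap.comp_apply, TensorProduct.map_tmul]
  generalize CA.comul j.1 (p - j.1) _ = t
  change mul2 ((TensorAlgebra.ι R).comp (Γg A CA B CB j.1 0))
    ((TensorAlgebra.ι R).comp (Γg A CA B CB (p - j.1) 0))
    (TensorProduct.tensorTensorTensorComm R (A j.1) (A (p - j.1)) (B 0) (B 0)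
      (t ⊗ₜ[R] CB.comul 0 0 (CB.coaug 1))) ∈ _
  rw [CB.coaug_grouplike]
  induction t using TensorProduct.induction_on with
  | zero => simp
  | tmul x y =>
    rw [TensorProduct.tensorTensorTensorComm_tmul, mul2_ι_Γg_tmul, genW_tmul_coaug,
      genW_tmul_coaug]
    exact genA_mul_mem_spanWordA A CA B CB _ x (genA_mem_spanWordA A CA B CB _ y)
  | add x y hx hy => rw [TensorProduct.add_tmul, map_add, map_add]; exact add_mem hx hy

theorem linT2_coaug_tmul_mem (q : ℕ) (b : B q) :
    linT2 A CA B CB 0 q (CA.coaug 1 ⊗ₜ[R] b) ∈ spanWordB A CA B CB := by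
  cases q with
  | zero => exact zero_mem _
  | succ q =>
    rw [linT2, LinearMap.smul_apply]
    refine zsmul_mem ?_ _
    change genW A CA B CB 0 q (CA.coaug 1 ⊗ₜ[R] CB.d q b) ∈ _
    rw [genW_coaug_tmul]
    exact genB_mem_spanWordB A CA B CB q _

theorem linT1_tmul_coaug_mem (p : ℕ) (a : A p) :
    linT1 A CA B CB p 0 (a ⊗ₜ[R] CB.coaug 1) ∈ spanWordA A CA B CB := by
  cases p with
  | zero => exact zero_mem _
  | succ p =>
    change genW A CA B CB p 0 (CA.d p a ⊗ₜ[R] CB.coaug 1) ∈ _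
    rw [genW_tmul_coaug]
    exact genA_mem_spanWordA A CA B CB p _

theorem dvalT_coaug_tmul_mem (q : ℕ) (b : B q) :
    dvalT A CA B CB 0 q (CA.coaug 1 ⊗ₜ[R] b) ∈ spanWordB A CA B CB := by
  have h1 : linT1 A CA B CB 0 q = 0 := rfl
  rw [dvalT, h1, neg_zero, zero_sub, LinearMap.add_apply, LinearMap.neg_apply]
  exact add_mem (neg_mem (linT2_coaug_tmul_mem A CA B CB q b))
    (quadT_coaug_tmul_mem A CA B CB q b)

theorem dvalT_tmul_coaug_mem (p : ℕ) (a : A p) :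
    dvalT A CA B CB p 0 (a ⊗ₜ[R] CB.coaug 1) ∈ spanWordA A CA B CB := by
  have h2 : linT2 A CA B CB p 0 = 0 := by cases p <;> rfl
  rw [dvalT, h2, sub_zero, LinearMap.add_apply, LinearMap.neg_apply]
  exact add_mem (neg_mem (linT1_tmul_coaug_mem A CA B CB p a))
    (quadT_tmul_coaug_mem A CA B CB p a)

end Coaugmentation

section Differential

variable {R : Type} [CommRing R] [CharP R 2]
variable (A : ℕ → Type) [∀ n, AddCommGroup (A n)] [∀ n, Module R (A n)] (CA : CoalgStr R A)
variable (B : ℕ → Type) [∀ n, AddCommGroup (B n)] [∀ n, Module R (B n)] (CB : CoalgStr R B)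
variable (dOm : Om A CA B CB →ₗ[R] Om A CA B CB) (hdOm1 : dOm 1 = 0)
  (hdOmL : ∀ (p q : ℕ) (z : A p ⊗[R] B q) (u : Om A CA B CB),
    dOm (genW A CA B CB p q z * u)
      = dvalT A CA B CB p q z * u
        + ((-1 : ℤ)^(p+q+1)) • (genW A CA B CB p q z * dOm u))
include hdOm1 hdOmL

theorem dOm_genW_mul (p q : ℕ) (z : A p ⊗[R] B q) (u : Om A CA B CB) :
    dOm (genW A CA B CB p q z * u)
      = dOm (genW A CA B CB p q z) * u + genW A CA B CB p q z * dOm u := by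
  have h1 := hdOmL p q z 1
  rw [mul_one, mul_one, hdOm1, mul_zero, smul_zero, add_zero] at h1
  rw [hdOmL, h1, neg_one_pow_zsmul_of_charP_two (R := R)]

omit [CharP R 2] in
theorem dOm_genW (p q : ℕ) (z : A p ⊗[R] B q) :
    dOm (genW A CA B CB p q z) = dvalT A CA B CB p q z := by
  simpa [hdOm1] using hdOmL p q z 1

omit [CharP R 2] in
theorem dOm_genB_mem (q : ℕ) (b : B q) :
    dOm (genB A CA B CB (embT B CB q b)) ∈ spanWordB A CA B CB := by
  rw [← genW_coaug_tmul, dOm_genW A CA B CB dOm hdOm1 hdOmL]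
  exact dvalT_coaug_tmul_mem A CA B CB q b

omit [CharP R 2] in
theorem dOm_genA_mem (p : ℕ) (a : A p) :
    dOm (genA A CA B CB (embT A CA p a)) ∈ spanWordA A CA B CB := by
  rw [← genW_tmul_coaug, dOm_genW A CA B CB dOm hdOm1 hdOmL]
  exact dvalT_tmul_coaug_mem A CA B CB p a

theorem dOm_genB_mul (q : ℕ) (b : B q) (u : Om A CA B CB) :
    dOm (genB A CA B CB (embT B CB q b) * u)
      = dOm (genB A CA B CB (embT B CB q b)) * u
        + genB A CA B CB (embT B CB q b) * dOm u := by
  rw [← genW_coaug_tmul, dOm_genW_mul A CA B CB dOm hdOm1 hdOmL]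

theorem dOm_genA_mul (p : ℕ) (a : A p) (u : Om A CA B CB) :
    dOm (genA A CA B CB (embT A CA p a) * u)
      = dOm (genA A CA B CB (embT A CA p a)) * u
        + genA A CA B CB (embT A CA p a) * dOm u := by
  rw [← genW_tmul_coaug, dOm_genW_mul A CA B CB dOm hdOm1 hdOmL]

theorem dOm_wordA_mem (l : List ((p : ℕ) × A p)) :
    dOm (wordA A CA B CB l) ∈ spanWordA A CA B CB := by
  induction l with
  | nil => rw [wordA_nil, hdOm1]; exact zero_mem _
  | cons t l ih =>
    rw [wordA_cons, dOm_genA_mul A CA B CB dOm hdOm1 hdOmL]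
    exact add_mem
      (mul_wordA_mem_spanWordA A CA B CB (dOm_genA_mem A CA B CB dOm hdOm1 hdOmL _ _) l)
      (genA_mul_mem_spanWordA A CA B CB _ _ ih)

theorem dOm_wordA_mul (l : List ((p : ℕ) × A p)) (u : Om A CA B CB) :
    dOm (wordA A CA B CB l * u) = dOm (wordA A CA B CB l) * u + wordA A CA B CB l * dOm u := by
  induction l with
  | nil => simp [hdOm1]
  | cons t l ih =>
    rw [wordA_cons, mul_assoc, dOm_genA_mul A CA B CB dOm hdOm1 hdOmL, ih,
      dOm_genA_mul A CA B CB dOm hdOm1 hdOmL]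
    noncomm_ring

end Differential

section Homotopy

variable {R : Type} [CommRing R]
variable (A : ℕ → Type) [∀ n, AddCommGroup (A n)] [∀ n, Module R (A n)] (CA : CoalgStr R A)
variable (B : ℕ → Type) [∀ n, AddCommGroup (B n)] [∀ n, Module R (B n)] (CB : CoalgStr R B)
variable (h : Om A CA B CB →ₗ[R] Om A CA B CB)
  (hhRec2 : ∀ (ω : Om A CA B CB) (q : ℕ) (b : B q) (α : List ((p : ℕ) × A p)),
    α ≠ [] → ∀ β : List ((r : ℕ) × B r),
    h (ω * genB A CA B CB (embT B CB q b) * wordA A CA B CB α * wordB A CA B CB β)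
      = ω * h (genB A CA B CB (embT B CB q b) * wordA A CA B CB α) * wordB A CA B CB β
        + h (ω * wordA A CA B CB α * genB A CA B CB (embT B CB q b) * wordB A CA B CB β))
include hhRec2

/-- The exchange rule for `h` with the word of `Ā`-letters replaced by a linear combination
of nonempty such words. -/
theorem h_exchange_spanWordA {X : Om A CA B CB} (hX : X ∈ spanWordA A CA B CB)
    (ω : Om A CA B CB) (q : ℕ) (b : B q) (β : List ((r : ℕ) × B r)) :
    h (ω * (genB A CA B CB (embT B CB q b) * X) * wordB A CA B CB β)
      = ω * h (genB A CA B CB (embT B CB q b) * X) * wordB A CA B CB β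
        + h (ω * (X * genB A CA B CB (embT B CB q b)) * wordB A CA B CB β) := by
  induction hX using Submodule.span_induction with
  | mem X hX =>
    obtain ⟨l, hl, rfl⟩ := hX
    simpa only [mul_assoc] using hhRec2 ω q b l hl β
  | zero => simp
  | add X Y _ _ hX hY =>
    simp only [mul_add, add_mul, map_add] at hX hY ⊢
    rw [hX, hY]
    abel
  | smul r X _ hX =>
    simp only [mul_smul_comm, smul_mul_assoc, map_smul] at hX ⊢
    rw [hX, smul_add]

variable (hhZero1 : ∀ (α : List ((p : ℕ) × A p)) (β : List ((r : ℕ) × B r)),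
    h (wordA A CA B CB α * wordB A CA B CB β) = 0)
include hhZero1

theorem h_exchange_wordB (l : List ((q : ℕ) × B q)) (ω : Om A CA B CB)
    (α : List ((p : ℕ) × A p)) (β : List ((r : ℕ) × B r)) :
    h (ω * (wordB A CA B CB l * wordA A CA B CB α) * wordB A CA B CB β)
      = ω * h (wordB A CA B CB l * wordA A CA B CB α) * wordB A CA B CB β
        + h (ω * (wordA A CA B CB α * wordB A CA B CB l) * wordB A CA B CB β) := by
  by_cases hα : α = []
  · subst hα
    have h0 := hhZero1 [] l
    rw [wordA_nil, one_mul] at h0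
    simp [h0]
  induction l generalizing ω β with
  | nil =>
    have h0 := hhZero1 α []
    rw [wordB_nil, mul_one] at h0
    simp [h0]
  | cons t l ih =>
    set g := genB A CA B CB (embT B CB t.1 t.2) with hg
    have expand (ω : Om A CA B CB) (β : List ((r : ℕ) × B r)) :
        h (ω * (wordB A CA B CB (t :: l) * wordA A CA B CB α) * wordB A CA B CB β)
          = ω * (g * h (wordB A CA B CB l * wordA A CA B CB α)
              + h (g * wordA A CA B CB α) * wordB A CA B CB l) * wordB A CA B CB β
            + h (ω * (wordA A CA B CB α * wordB A CA B CB (t :: l)) * wordB A CA B CB β) := by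
      have e1 := ih (ω * g) β
      have e2 := hhRec2 ω t.1 t.2 α hα (l ++ β)
      simp only [wordB_append, ← hg, mul_assoc] at e1 e2
      simp only [wordB_cons, ← hg, mul_add, add_mul, mul_assoc]
      rw [e1, e2, add_assoc]
    have base := expand 1 []
    rw [wordB_nil, mul_one, mul_one, one_mul, one_mul, one_mul, mul_one, hhZero1,
      add_zero] at base
    rw [expand, base]

/-- The exchange rule for `h` with the letter from `B̄` replaced by a linear combination of
words of such letters. -/
theorem h_exchange_spanWordB {D : Om A CA B CB} (hD : D ∈ spanWordB A CA B CB)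
    (ω : Om A CA B CB) (α : List ((p : ℕ) × A p)) (β : List ((r : ℕ) × B r)) :
    h (ω * (D * wordA A CA B CB α) * wordB A CA B CB β)
      = ω * h (D * wordA A CA B CB α) * wordB A CA B CB β
        + h (ω * (wordA A CA B CB α * D) * wordB A CA B CB β) := by
  induction hD using Submodule.span_induction with
  | mem D hD =>
    obtain ⟨l, rfl⟩ := hD
    exact h_exchange_wordB A CA B CB h hhRec2 hhZero1 l ω α β
  | zero => simp
  | add X Y _ _ hX hY =>
    simp only [mul_add, add_mul, map_add] at hX hY ⊢
    rw [hX, hY]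
    abel
  | smul r X _ hX =>
    simp only [mul_smul_comm, smul_mul_assoc, map_smul] at hX ⊢
    rw [hX, smul_add]

end Homotopy

/-- Let `A`, `B` be coaugmented chain coalgebras over a commutative
ring `R` of characteristic 2, and `h` the natural degree `+1` homotopy on `Ω (A ⊗ B)`.
Then for every word `ω`, every `b ∈ B̄`, every word `α` of letters from `Ā` and every
word `β` of letters from `B̄`,
`h([ω](d[b|α])[β]) = [ω](h d [b|α])[β] + h([ω](d[α|b])[β])`. -/
theorem homotopy_differential_exchange_lemma
    (R : Type) [CommRing R] [CharP R 2]
    (A : ℕ → Type) [∀ n, AddCommGroup (A n)] [∀ n, Module R (A n)] (CA : CoalgStr R A)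
    (B : ℕ → Type) [∀ n, AddCommGroup (B n)] [∀ n, Module R (B n)] (CB : CoalgStr R B)
    -- the cobar differential of Ω (A ⊗ B)
    (dOm : Om A CA B CB →ₗ[R] Om A CA B CB)
    (hdOm1 : dOm 1 = 0)
    (hdOmL : ∀ (p q : ℕ) (z : A p ⊗[R] B q) (u : Om A CA B CB),
      dOm (genW A CA B CB p q z * u)
        = dvalT A CA B CB p q z * u
          + ((-1 : ℤ)^(p+q+1)) • (genW A CA B CB p q z * dOm u))
    -- the natural homotopy h, characterized by its defining recursion (mod 2)
    (h : Om A CA B CB →ₗ[R] Om A CA B CB)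
    (hh1 : h 1 = 0)
    (hhEnd : ∀ (u : Om A CA B CB) (t : Big A CA ⊗[R] Big B CB), h (u * genT A CA B CB t) = 0)
    (hhBase : ∀ (p q : ℕ) (a : A p) (b : B q),
      h (genB A CA B CB (embT B CB q b) * genA A CA B CB (embT A CA p a))
        = genT A CA B CB (embT A CA p a ⊗ₜ[R] embT B CB q b))
    (hhRec1 : ∀ (q : ℕ) (b : B q) (α : List ((p : ℕ) × A p)) (x : Big A CA),
      h (genB A CA B CB (embT B CB q b) * wordA A CA B CB α * genA A CA B CB x)
        = wordA A CA B CB α * genT A CA B CB (x ⊗ₜ[R] embT B CB q b)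
          + h (genB A CA B CB (embT B CB q b) * wordA A CA B CB α) * genA A CA B CB x
          + sweedC A CA B CB h α x (bigDiag B CB q b))
    (hhRec2 : ∀ (ω : Om A CA B CB) (q : ℕ) (b : B q) (α : List ((p : ℕ) × A p)),
      α ≠ [] → ∀ β : List ((r : ℕ) × B r),
      h (ω * genB A CA B CB (embT B CB q b) * wordA A CA B CB α * wordB A CA B CB β)
        = ω * h (genB A CA B CB (embT B CB q b) * wordA A CA B CB α) * wordB A CA B CB β
          + h (ω * wordA A CA B CB α * genB A CA B CB (embT B CB q b) * wordB A CA B CB β))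
    (hhZero1 : ∀ (α : List ((p : ℕ) × A p)) (β : List ((r : ℕ) × B r)),
      h (wordA A CA B CB α * wordB A CA B CB β) = 0)
    (hhZero2 : ∀ (ω : Om A CA B CB) (t : Big A CA ⊗[R] Big B CB)
        (α : List ((p : ℕ) × A p)) (β : List ((r : ℕ) × B r)),
      h (ω * genT A CA B CB t * wordA A CA B CB α * wordB A CA B CB β) = 0)
    : ∀ (ω : Om A CA B CB) (q : ℕ) (b : B q) (α : List ((p : ℕ) × A p))
        (β : List ((r : ℕ) × B r)),
      h (ω * dOm (genB A CA B CB (embT B CB q b) * wordA A CA B CB α) * wordB A CA B CB β)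
      = ω * h (dOm (genB A CA B CB (embT B CB q b) * wordA A CA B CB α)) * wordB A CA B CB β
        + h (ω * dOm (wordA A CA B CB α * genB A CA B CB (embT B CB q b)) * wordB A CA B CB β) := by
  intro ω q b α β
  have eD := h_exchange_spanWordB A CA B CB h hhRec2 hhZero1
    (dOm_genB_mem A CA B CB dOm hdOm1 hdOmL q b) ω α β
  have eX := h_exchange_spanWordA A CA B CB h hhRec2
    (dOm_wordA_mem A CA B CB dOm hdOm1 hdOmL α) ω q b β
  rw [dOm_genB_mul A CA B CB dOm hdOm1 hdOmL, dOm_wordA_mul A CA B CB dOm hdOm1 hdOmL]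
  simp only [mul_add, add_mul, map_add]
  rw [eD, eX]
  abel

end CJ2
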